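/- arXiv:0810.1804 — 2 statements merged into one kernel-verified Lean document; each statement's English description precedes it below -/
import Mathlib

section
/- Assume in addition that G is abelian. Then for every e with q = p^e ≥ |G|, and for every simple finite-dimensional k-linear representation U of G, there is an injective G-equivariant k-linear map from U into the quotient S/I_q, where I_q ⊆ S is the G-stable ideal generated by x_1^q, …, x_d^q. -/
set_option synthInstance.maxHeartbeats 1000000
set_option maxHeartbeats 1000000

open MvPolynomial

/-- The Frobenius power `m^{[q]} = (x_1^q, …, x_d^q)` of the homogeneous maximal ideal of
the polynomial ring `k[x_1, …, x_d]`. -/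
noncomputable def frobeniusPowerIdeal (k : Type*) [Field k] (d q : ℕ) :
    Ideal (MvPolynomial (Fin d) k) :=
  Ideal.span (Set.range fun i : Fin d => (X i : MvPolynomial (Fin d) k) ^ q)

section Characters

variable {k A : Type*} [Field k] [CommGroup A] [Finite A]
  [HasEnoughRootsOfUnity k (Monoid.exponent A)]

theorem sum_monoidHom_units_apply_eq_zero [Fintype (A →* kˣ)] {g : A} (hg : g ≠ 1) :
    ∑ χ : A →* kˣ, ((χ g : kˣ) : k) = 0 := by
  obtain ⟨ψ, hψ⟩ := CommGroup.exists_apply_ne_one_of_hasEnoughRootsOfUnity A k hg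
  have h : ((ψ g : kˣ) : k) * ∑ χ : A →* kˣ, ((χ g : kˣ) : k) =
      ∑ χ : A →* kˣ, ((χ g : kˣ) : k) := by
    rw [Finset.mul_sum]
    exact Fintype.sum_equiv (Equiv.mulLeft ψ) _ _ fun χ => by simp
  by_contra h0
  exact hψ (Units.ext (mul_eq_right₀ h0 |>.mp h))

/-- An invariant subspace of a representation of a finite abelian group of invertible order is
spanned by simultaneous eigenvectors. -/
theorem Representation.le_span_eigenvectors {M : Type*} [AddCommGroup M] [Module k M]
    (hA : (Nat.card A : k) ≠ 0) (ρ : Representation k A M) (W : Submodule k M)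
    (hW : ∀ g, ∀ w ∈ W, ρ g w ∈ W) :
    W ≤ Submodule.span k {w | w ∈ W ∧ ∃ χ : A →* kˣ, ∀ g, ρ g w = (χ g : k) • w} := by
  classical
  have := Fintype.ofFinite A
  have : Finite (A →* kˣ) := Nat.finite_of_card_ne_zero <| by
    rw [CommGroup.card_monoidHom_of_hasEnoughRootsOfUnity]; exact Nat.card_pos.ne'
  have := Fintype.ofFinite (A →* kˣ)
  intro w hw
  let P : (A →* kˣ) → M := fun χ => ∑ g, ((χ g⁻¹ : kˣ) : k) • ρ g w
  have hsum : ∑ χ, P χ = (Nat.card A : k) • w := by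
    rw [Finset.sum_comm]
    simp_rw [← Finset.sum_smul]
    rw [Finset.sum_eq_single 1]
    · rw [← CommGroup.card_monoidHom_of_hasEnoughRootsOfUnity A k]
      simp
    · intro g _ hg
      rw [sum_monoidHom_units_apply_eq_zero (inv_ne_one.mpr hg), zero_smul]
    · simp
  have hP : ∀ χ, P χ ∈ W ∧ ∃ χ' : A →* kˣ, ∀ g, ρ g (P χ) = (χ' g : k) • P χ := by
    refine fun χ => ⟨Submodule.sum_mem _ fun g _ => Submodule.smul_mem _ _ (hW g w hw), χ,
      fun h => ?_⟩
    simp only [P, map_sum, map_smul, Finset.smul_sum, smul_smul]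
    refine Fintype.sum_equiv (Equiv.mulLeft h) _ _ fun g => ?_
    rw [Equiv.coe_mulLeft, map_mul ρ, Module.End.mul_apply, ← Units.val_mul, ← map_mul χ]
    simp
  have : w = (Nat.card A : k)⁻¹ • ∑ χ, P χ := by
    rw [hsum, inv_smul_smul₀ hA]
  rw [this]
  exact Submodule.smul_mem _ _ (Submodule.sum_mem _ fun χ _ => Submodule.subset_span (hP χ))

/-- A jointly faithful family of characters of a finite abelian group generates its dual. -/
theorem exists_prod_pow_eq_of_jointly_faithful {ι : Type*} [Fintype ι] (χ : ι → A →* kˣ)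
    (hχ : ∀ g, (∀ i, χ i g = 1) → g = 1) (ψ : A →* kˣ) :
    ∃ a : ι → ℕ, (∀ i, a i < Nat.card A) ∧ ψ = ∏ i, χ i ^ a i := by
  have hcard := CommGroup.card_monoidHom_of_hasEnoughRootsOfUnity A k
  have htop : Subgroup.closure (Set.range χ) = ⊤ := by
    have hbot : (CommGroup.subgroupOrderIsoSubgroupMonoidHom A k).symm
        (OrderDual.toDual (Subgroup.closure (Set.range χ))) = ⊥ := by
      rw [eq_bot_iff]
      intro g hg
      rw [CommGroup.mem_subgroupOrderIsoSubgroupMonoidHom_symm_iff] at hg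
      exact hχ g fun i => hg _ (Subgroup.subset_closure ⟨i, rfl⟩)
    rw [OrderIso.symm_apply_eq, map_bot] at hbot
    exact hbot
  obtain ⟨z, hz⟩ := Subgroup.exists_of_mem_closure_range χ ψ (htop ▸ Subgroup.mem_top ψ)
  have hpos : (0 : ℤ) < Nat.card A := by exact_mod_cast Nat.card_pos
  have hnonneg i : 0 ≤ z i % (Nat.card A : ℤ) := Int.emod_nonneg _ hpos.ne'
  refine ⟨fun i => (z i % (Nat.card A : ℤ)).toNat, fun i => ?_, ?_⟩
  · have := Int.emod_lt_of_pos (z i) hpos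
    exact (Int.toNat_lt (hnonneg i)).mpr this
  · rw [hz]
    refine Finset.prod_congr rfl fun i _ => ?_
    refine Eq.trans ?_ (zpow_natCast (χ i) _)
    rw [Int.toNat_of_nonneg (hnonneg i), ← hcard, zpow_mod_natCard]

theorem Representation.exists_eigenvector_of_simple {U : Type*} [AddCommGroup U] [Module k U]
    [Nontrivial U] (hA : (Nat.card A : k) ≠ 0) (ρ : Representation k A U)
    (hρ : ∀ W : Submodule k U, (∀ g, ∀ u ∈ W, ρ g u ∈ W) → W = ⊥ ∨ W = ⊤) :
    ∃ u ≠ 0, Submodule.span k {u} = ⊤ ∧ ∃ χ : A →* kˣ, ∀ g, ρ g u = (χ g : k) • u := by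
  obtain ⟨u, hu0, χ, hu⟩ : ∃ u ≠ 0, ∃ χ : A →* kˣ, ∀ g, ρ g u = (χ g : k) • u := by
    by_contra! h
    have hle := ρ.le_span_eigenvectors hA ⊤ fun _ _ _ => Submodule.mem_top
    refine bot_ne_top (α := Submodule k U)
      (eq_top_iff.mpr (hle.trans (Submodule.span_le.mpr ?_)))
    rintro w ⟨-, χ, hw⟩
    by_contra hw0
    obtain ⟨g, hg⟩ := h w hw0 χ
    exact hg (hw g)
  refine ⟨u, hu0, (hρ _ fun g w hw => ?_).resolve_left ?_, χ, hu⟩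
  · obtain ⟨c, rfl⟩ := Submodule.mem_span_singleton.mp hw
    rw [map_smul, hu]
    exact Submodule.smul_mem _ _ (Submodule.smul_mem _ _ (Submodule.mem_span_singleton_self u))
  · rwa [Submodule.span_singleton_eq_bot]

end Characters

section FrobeniusPower

variable {k : Type*} [Field k] {d : ℕ}

theorem pow_mem_frobeniusPowerIdeal (p e : ℕ) [Fact p.Prime] [CharP k p]
    {v : MvPolynomial (Fin d) k}
    (hv : v ∈ Submodule.span k (Set.range (X : Fin d → MvPolynomial (Fin d) k))) :
    v ^ p ^ e ∈ frobeniusPowerIdeal k d (p ^ e) := by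
  have hq : p ^ e ≠ 0 := pow_ne_zero _ (Fact.out : p.Prime).ne_zero
  induction hv using Submodule.span_induction with
  | mem v hv =>
    obtain ⟨i, rfl⟩ := hv
    exact Ideal.subset_span ⟨i, rfl⟩
  | zero => rw [zero_pow hq]; exact zero_mem _
  | add v w _ _ hv hw => rw [add_pow_char_pow]; exact add_mem hv hw
  | smul c v _ hv => rw [smul_pow, smul_eq_C_mul]; exact Ideal.mul_mem_left _ _ hv

theorem map_mem_frobeniusPowerIdeal (p e : ℕ) [Fact p.Prime] [CharP k p]
    (f : MvPolynomial (Fin d) k →ₐ[k] MvPolynomial (Fin d) k)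
    (hf : ∀ i, f (X i) ∈ Submodule.span k (Set.range (X : Fin d → MvPolynomial (Fin d) k)))
    {s : MvPolynomial (Fin d) k} (hs : s ∈ frobeniusPowerIdeal k d (p ^ e)) :
    f s ∈ frobeniusPowerIdeal k d (p ^ e) := by
  suffices frobeniusPowerIdeal k d (p ^ e) ≤ (frobeniusPowerIdeal k d (p ^ e)).comap f from this hs
  refine Ideal.span_le.mpr ?_
  rintro _ ⟨i, rfl⟩
  rw [SetLike.mem_coe, Ideal.mem_comap, map_pow]
  exact pow_mem_frobeniusPowerIdeal p e (hf i)

theorem monomial_notMem_frobeniusPowerIdeal {q : ℕ} {a : Fin d →₀ ℕ} (ha : ∀ i, a i < q) :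
    monomial a (1 : k) ∉ frobeniusPowerIdeal k d q := by
  have : frobeniusPowerIdeal k d q = Ideal.span
      ((fun s => monomial s (1 : k)) '' Set.range fun i => Finsupp.single i q) := by
    rw [frobeniusPowerIdeal, ← Set.range_comp]
    simp [Function.comp_def, X_pow_eq_monomial]
  rw [this, mem_ideal_span_monomial_image]
  intro h
  obtain ⟨_, ⟨i, rfl⟩, hi⟩ := h a (by simp [mem_support_iff])
  have := hi i
  simp only [Finsupp.single_eq_same] at this
  exact (ha i).not_ge this

/-- Monomials with exponents below `q` in any basis of the linear forms lie outside `m^{[q]}`. -/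
theorem prod_pow_notMem_frobeniusPowerIdeal (p e : ℕ) [Fact p.Prime] [CharP k p]
    {κ : Type*} [Fintype κ] {y : κ → MvPolynomial (Fin d) k} (hy : LinearIndependent k y)
    (hspan : Submodule.span k (Set.range y) =
      Submodule.span k (Set.range (X : Fin d → MvPolynomial (Fin d) k)))
    {a : κ → ℕ} (ha : ∀ i, a i < p ^ e) :
    ∏ i, y i ^ a i ∉ frobeniusPowerIdeal k d (p ^ e) := by
  have hcard : Fintype.card κ = Fintype.card (Fin d) := by
    rw [← finrank_span_eq_card hy, hspan, finrank_span_eq_card (linearIndependent_X (Fin d) k)]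
  let σ : κ ≃ Fin d := Fintype.equivOfCardEq hcard
  obtain ⟨L, hL⟩ := ((Module.Basis.span hy).constr k fun i =>
    (X (σ i) : MvPolynomial (Fin d) k)).exists_extend
  have hLy i : L (y i) = X (σ i) := by
    have h := LinearMap.congr_fun hL (Module.Basis.span hy i)
    rw [Module.Basis.constr_basis, LinearMap.comp_apply, Submodule.subtype_apply,
      Module.Basis.span_apply] at h
    exact h
  have hLX i : L (X i) ∈ Submodule.span k (Set.range (X : Fin d → MvPolynomial (Fin d) k)) := by
    have hX : (X i : MvPolynomial (Fin d) k) ∈ Submodule.span k (Set.range y) :=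
      hspan ▸ Submodule.subset_span ⟨i, rfl⟩
    have := Submodule.mem_map_of_mem (f := L) hX
    rw [Submodule.map_span, ← Set.range_comp] at this
    refine Submodule.span_mono ?_ this
    rintro _ ⟨j, rfl⟩
    exact ⟨σ j, (hLy j).symm⟩
  let f : MvPolynomial (Fin d) k →ₐ[k] MvPolynomial (Fin d) k := aeval fun i => L (X i)
  have hf {v : MvPolynomial (Fin d) k}
      (hv : v ∈ Submodule.span k (Set.range (X : Fin d → MvPolynomial (Fin d) k))) :
      f v = L v := by
    refine LinearMap.eqOn_span (f := f.toLinearMap) (g := L) ?_ hv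
    rintro _ ⟨i, rfl⟩
    simp [f]
  intro h
  have h' := map_mem_frobeniusPowerIdeal p e f (fun i => by simpa [f] using hLX i) h
  have heq : f (∏ i, y i ^ a i) =
      monomial (Finsupp.equivFunOnFinite.symm (a ∘ σ.symm)) (1 : k) := by
    rw [map_prod, monomial_eq, map_one, one_mul, Finsupp.prod_fintype _ _ (by simp)]
    refine Fintype.prod_equiv σ _ _ fun i => ?_
    rw [map_pow, hf (hspan ▸ Submodule.subset_span ⟨i, rfl⟩), hLy]
    simp
  rw [heq] at h'
  exact monomial_notMem_frobeniusPowerIdeal (fun i => by simpa using ha _) h'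

/-- Every character of a finite abelian group acting faithfully and linearly occurs as the
eigencharacter of a polynomial outside `m^{[q]}` once `q` is at least the order of the group. -/
theorem exists_eigenvector_notMem_frobeniusPowerIdeal (p e : ℕ) [Fact p.Prime] [CharP k p]
    {A : Type*} [CommGroup A] [Finite A] [HasEnoughRootsOfUnity k (Monoid.exponent A)]
    (hA : (Nat.card A : k) ≠ 0)
    (α : A →* (MvPolynomial (Fin d) k ≃ₐ[k] MvPolynomial (Fin d) k))
    (hα : Function.Injective α)
    (hlin : ∀ g i, α g (X i) ∈
      Submodule.span k (Set.range (X : Fin d → MvPolynomial (Fin d) k)))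
    (hq : Nat.card A ≤ p ^ e) (ψ : A →* kˣ) :
    ∃ m ∉ frobeniusPowerIdeal k d (p ^ e), ∀ g, α g m = (ψ g : k) • m := by
  let V := Submodule.span k (Set.range (X : Fin d → MvPolynomial (Fin d) k))
  let ρ : Representation k A (MvPolynomial (Fin d) k) :=
    { toFun := fun g => (α g).toLinearMap
      map_one' := by rw [map_one]; rfl
      map_mul' := fun g h => by rw [map_mul]; rfl }
  have hV : ∀ g, ∀ v ∈ V, ρ g v ∈ V := by
    intro g
    suffices V ≤ V.comap (ρ g) from this
    refine Submodule.span_le.mpr ?_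
    rintro _ ⟨i, rfl⟩
    exact hlin g i
  have hspanV := le_antisymm (ρ.le_span_eigenvectors hA V hV)
    (Submodule.span_le.mpr fun w hw => hw.1)
  obtain ⟨κ, a, -, hspan, hli⟩ := exists_linearIndependent' k
    (Subtype.val : {w | w ∈ V ∧ ∃ χ : A →* kˣ, ∀ g, ρ g w = (χ g : k) • w} → _)
  rw [Subtype.range_coe, ← hspanV] at hspan
  set y : κ → MvPolynomial (Fin d) k := Subtype.val ∘ a with hy
  have : FiniteDimensional k V := FiniteDimensional.span_of_finite k (Set.finite_range _)
  have : Finite κ := by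
    have hli' : LinearIndependent k fun i => (⟨y i, (a i).2.1⟩ : V) :=
      LinearIndependent.of_comp V.subtype hli
    exact hli'.finite
  have := Fintype.ofFinite κ
  choose χ hχ using fun i => (a i).2.2
  have hχy i g : α g (y i) = (χ i g : k) • y i := hχ i g
  have hfaith : ∀ g, (∀ i, χ i g = 1) → g = 1 := by
    intro g hg
    apply hα
    rw [map_one]
    have heq : Set.EqOn (ρ g) (LinearMap.id : _ →ₗ[k] MvPolynomial (Fin d) k) V := by
      rw [← hspan]
      refine LinearMap.eqOn_span ?_
      rintro _ ⟨i, rfl⟩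
      refine (hχy i g).trans ?_
      simp [hg i]
    apply AlgEquiv.coe_toAlgHom_injective
    ext1 i
    exact heq (Submodule.subset_span ⟨i, rfl⟩)
  obtain ⟨c, hc, rfl⟩ := exists_prod_pow_eq_of_jointly_faithful χ hfaith ψ
  refine ⟨∏ i, y i ^ c i,
    prod_pow_notMem_frobeniusPowerIdeal p e hli hspan fun i => (hc i).trans_le hq, fun g => ?_⟩
  simp_rw [map_prod, map_pow, hχy, smul_pow, Finset.prod_smul]
  simp [MonoidHom.finsetProd_apply]

end FrobeniusPower

/-- Let `k` be an algebraically closed field of characteristic `p > 0`,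
`S = k[x_1, …, x_d]` with `d ≥ 1`, and `G` a finite *abelian* group of `k`-algebra
automorphisms of `S` acting linearly on the variables, with `p ∤ |G|`. Then for every `e`
with `q = p^e ≥ |G|`, every simple finite-dimensional `k`-linear representation `U` of `G`
embeds `G`-equivariantly and `k`-linearly into `S/m^{[q]}`. -/
theorem statement3 (k : Type) [Field k] [IsAlgClosed k] (p : ℕ) (hp : p.Prime) [CharP k p]
    (d : ℕ) (hd : 1 ≤ d)
    (G : Subgroup (MvPolynomial (Fin d) k ≃ₐ[k] MvPolynomial (Fin d) k)) [Finite G]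
    (hlin : ∀ (g : G) (i : Fin d),
      (g : MvPolynomial (Fin d) k ≃ₐ[k] MvPolynomial (Fin d) k) (X i) ∈
        Submodule.span k (Set.range (X : Fin d → MvPolynomial (Fin d) k)))
    (hord : ¬ p ∣ Nat.card G)
    (habel : ∀ a b : G, a * b = b * a) :
    ∀ e : ℕ, Nat.card G ≤ p ^ e →
      ∀ (U : Type) [AddCommGroup U] [Module k U] (ρ : Representation k G U),
        FiniteDimensional k U → Nontrivial U →
        (∀ W : Submodule k U, (∀ (g : G), ∀ u ∈ W, ρ g u ∈ W) → W = ⊥ ∨ W = ⊤) →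
        ∃ φ : U →ₗ[k] (MvPolynomial (Fin d) k ⧸ frobeniusPowerIdeal k d (p ^ e)),
          Function.Injective φ ∧
          ∀ (g : G) (u : U) (s : MvPolynomial (Fin d) k),
            Ideal.Quotient.mk (frobeniusPowerIdeal k d (p ^ e)) s = φ u →
            Ideal.Quotient.mk (frobeniusPowerIdeal k d (p ^ e))
                ((g : MvPolynomial (Fin d) k ≃ₐ[k] MvPolynomial (Fin d) k) s) =
              φ (ρ g u) := by
  intro e hq U _ _ ρ _ _ hρ
  have : Fact p.Prime := ⟨hp⟩
  let _ : CommGroup G := { (inferInstance : Group G) with mul_comm := habel }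
  have hG : (Nat.card G : k) ≠ 0 := fun h => hord ((CharP.cast_eq_zero_iff k p _).mp h)
  have : NeZero (Monoid.exponent G : k) := ⟨fun h => hord
    (((CharP.cast_eq_zero_iff k p _).mp h).trans Group.exponent_dvd_nat_card)⟩
  obtain ⟨u₀, hu₀, htop, ψ, hψ⟩ := Representation.exists_eigenvector_of_simple hG ρ hρ
  obtain ⟨m, hm, hmψ⟩ := exists_eigenvector_notMem_frobeniusPowerIdeal p e hG G.subtype
    Subtype.val_injective hlin hq ψ
  obtain ⟨f, hf⟩ := Module.Projective.exists_dual_ne_zero k hu₀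
  set I := frobeniusPowerIdeal k d (p ^ e)
  have hm' : Ideal.Quotient.mk I m ≠ 0 := fun h => hm (Ideal.Quotient.eq_zero_iff_mem.mp h)
  have hspan (u : U) : ∃ c : k, c • u₀ = u :=
    Submodule.mem_span_singleton.mp (htop ▸ Submodule.mem_top)
  refine ⟨f.smulRight (Ideal.Quotient.mk I m), ?_, ?_⟩
  · refine (injective_iff_map_eq_zero _).mpr fun u hu => ?_
    obtain ⟨c, rfl⟩ := hspan u
    have hc : c = 0 := by simpa [hf, hm'] using hu
    rw [hc, zero_smul]
  · intro g u s hs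
    obtain ⟨c, rfl⟩ := hspan u
    have hsub : s - f (c • u₀) • m ∈ I := Ideal.Quotient.eq.mp hs
    have hgsub := map_mem_frobeniusPowerIdeal p e
      ((g : MvPolynomial (Fin d) k ≃ₐ[k] MvPolynomial (Fin d) k) : _ →ₐ[k] _) (hlin g) hsub
    have hgm : (g : MvPolynomial (Fin d) k ≃ₐ[k] _) m = (ψ g : k) • m := hmψ g
    have hval : f (ρ g (c • u₀)) • m =
        (g : MvPolynomial (Fin d) k ≃ₐ[k] _) (f (c • u₀) • m) := by
      rw [map_smul, map_smul, map_smul, hψ, hgm]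
      simp only [map_smul, smul_smul, smul_eq_mul]
      ring_nf
    change _ = Ideal.Quotient.mk I (f (ρ g (c • u₀)) • m)
    rw [hval, Ideal.Quotient.eq, ← map_sub]
    exact hgsub
end

section
/- There exists e_0 such that for all e ≥ e_0, setting q = p^e, the following holds: for every irreducible finite-dimensional k-linear representation U of G, the module of covariants over R^q, namely R^q(U) := (S^q ⊗_k U)^G (the G-fixed points of S^q ⊗_k U under the diagonal action, an R^q-module), is isomorphic to a direct summand of R as an R^q-module; that is, there exist R^q-linear maps ι : (S^q ⊗_k U)^G → R and π : R → (S^q ⊗_k U)^G with π ∘ ι = id. (In other words, R is a full module of covariants over R^q.) -/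
set_option synthInstance.maxHeartbeats 1000000
set_option maxHeartbeats 1000000

open MvPolynomial TensorProduct

/-- The `k`-subalgebra `S^q = {f^q : f ∈ S}` of `q`-th powers (`q = p^e`) of the polynomial
ring `S = k[x_1, …, x_d]` over an algebraically closed (hence perfect) field `k` of
characteristic `p`. -/
noncomputable def qthPowersSubalgebra (k : Type) [Field k] [IsAlgClosed k]
    (p : ℕ) (hp : p.Prime) [CharP k p] (d e : ℕ) :
    Subalgebra k (MvPolynomial (Fin d) k) where
  carrier := Set.range fun f : MvPolynomial (Fin d) k => f ^ p ^ e
  mul_mem' := by rintro a b ⟨x, rfl⟩ ⟨y, rfl⟩; exact ⟨x * y, mul_pow x y _⟩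
  one_mem' := ⟨1, one_pow _⟩
  add_mem' := by
    haveI := Fact.mk hp
    rintro a b ⟨x, rfl⟩ ⟨y, rfl⟩
    exact ⟨x + y, add_pow_char_pow ..⟩
  zero_mem' := ⟨0, zero_pow (pow_ne_zero e hp.ne_zero)⟩
  algebraMap_mem' := fun a => by
    obtain ⟨b, hb⟩ := IsAlgClosed.exists_pow_nat_eq a (n := p ^ e) (pow_pos hp.pos e)
    exact ⟨C b, by simp only []; rw [← map_pow, hb, MvPolynomial.algebraMap_eq]⟩

/-- The action of `g ∈ G` restricted to the subalgebra `S^q` of `q`-th powers. -/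
noncomputable def qthPowersRestrict (k : Type) [Field k] [IsAlgClosed k]
    (p : ℕ) (hp : p.Prime) [CharP k p] (d e : ℕ)
    (G : Subgroup (MvPolynomial (Fin d) k ≃ₐ[k] MvPolynomial (Fin d) k)) (g : G) :
    ↥(qthPowersSubalgebra k p hp d e) →ₗ[k] ↥(qthPowersSubalgebra k p hp d e) where
  toFun s := ⟨(g : MvPolynomial (Fin d) k ≃ₐ[k] MvPolynomial (Fin d) k) s, by
    obtain ⟨f, hf⟩ := s.2
    exact ⟨(g : MvPolynomial (Fin d) k ≃ₐ[k] MvPolynomial (Fin d) k) f,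
      by simp only []; rw [← map_pow]; exact congrArg _ hf⟩⟩
  map_add' a b := Subtype.ext (by push_cast; exact map_add _ _ _)
  map_smul' c a := Subtype.ext (by push_cast; exact map_smul _ c _)

/-- The module of covariants over `R^q`: the `G`-fixed points `(S^q ⊗_k U)^G` of
`S^q ⊗_k U` under the diagonal action. -/
noncomputable def qCovariants (k : Type) [Field k] [IsAlgClosed k]
    (p : ℕ) (hp : p.Prime) [CharP k p] (d e : ℕ)
    (G : Subgroup (MvPolynomial (Fin d) k ≃ₐ[k] MvPolynomial (Fin d) k))
    (U : Type) [AddCommGroup U] [Module k U] (ρ : Representation k G U) :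
    Submodule k (↥(qthPowersSubalgebra k p hp d e) ⊗[k] U) :=
  ⨅ g : G, LinearMap.eqLocus
    (TensorProduct.map (qthPowersRestrict k p hp d e G g) (ρ g)) LinearMap.id

/-- The invariant ring `R = S^G` as a subalgebra of `S = k[x_1, …, x_d]`. -/
noncomputable def invariantsSubalgebra (k : Type) [Field k] (d : ℕ)
    (G : Subgroup (MvPolynomial (Fin d) k ≃ₐ[k] MvPolynomial (Fin d) k)) :
    Subalgebra k (MvPolynomial (Fin d) k) where
  carrier := {s | ∀ g : G, (g : MvPolynomial (Fin d) k ≃ₐ[k] MvPolynomial (Fin d) k) s = s}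
  mul_mem' ha hb g := by rw [map_mul, ha g, hb g]
  one_mem' g := map_one _
  add_mem' ha hb g := by rw [map_add, ha g, hb g]
  zero_mem' g := map_zero _
  algebraMap_mem' a g := AlgEquiv.commutes _ a

section

variable {k : Type} [Field k] {d : ℕ}

/-- Distinct automorphisms stay linearly independent over `k` after restriction to the polynomials
all of whose translates have degree less than some fixed bound. -/
theorem exists_totalDegree_bound_sum_ne_zero
    (G : Subgroup (MvPolynomial (Fin d) k ≃ₐ[k] MvPolynomial (Fin d) k)) [Fintype G] :
    ∃ N : ℕ, ∀ c : G → k, c ≠ 0 → ∃ f : MvPolynomial (Fin d) k,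
      (∀ g : G, (g.1 f).totalDegree < N) ∧ ∑ g : G, c g • g.1 f ≠ 0 := by
  let K : ℕ → Submodule k (G → k) := fun N =>
    { carrier := {c | ∀ f : MvPolynomial (Fin d) k, (∀ g : G, (g.1 f).totalDegree < N) →
        ∑ g : G, c g • g.1 f = 0}
      add_mem' := fun {a b} ha hb f hf => by
        simp only [Pi.add_apply, add_smul, Finset.sum_add_distrib, ha f hf, hb f hf, add_zero]
      zero_mem' := fun f _ => by simp
      smul_mem' := fun r a ha f hf => by
        simp only [Pi.smul_apply, smul_assoc, ← Finset.smul_sum, ha f hf, smul_zero] }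
  have hK : Antitone K := fun M N h c hc f hf => hc f fun g => (hf g).trans_le h
  obtain ⟨N, hN⟩ := IsArtinian.monotone_stabilizes
    (⟨fun n => OrderDual.toDual (K n), fun _ _ h => hK h⟩ : ℕ →o (Submodule k (G → k))ᵒᵈ)
  refine ⟨N, fun c hc => ?_⟩
  by_contra! hcon
  have hcN : c ∈ K N := hcon
  have hall : ∀ f : MvPolynomial (Fin d) k, ∑ g : G, c g • g.1 f = 0 := by
    intro f
    let B := ∑ g : G, ((g.1 f).totalDegree + 1)
    have hB : ∀ g : G, (g.1 f).totalDegree < max N B := fun g =>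
      lt_max_of_lt_right (Finset.single_le_sum (f := fun g : G => (g.1 f).totalDegree + 1)
        (fun _ _ => Nat.zero_le _) (Finset.mem_univ g))
    have h : K N = K (max N B) := hN _ (le_max_left _ _)
    exact (h ▸ hcN) f hB
  have hind := (linearIndependent_monoidHom (MvPolynomial (Fin d) k)
    (MvPolynomial (Fin d) k)).comp
    (fun g : G => ((g.1 : MvPolynomial (Fin d) k →* MvPolynomial (Fin d) k)))
    (fun g h hgh => Subtype.ext (AlgEquiv.ext fun x => DFunLike.congr_fun hgh x))
  rw [Fintype.linearIndependent_iff] at hind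
  refine hc (funext fun g => C_injective (Fin d) k ?_)
  rw [Pi.zero_apply, map_zero]
  refine hind (fun g => C (c g)) (funext fun f => ?_) g
  simpa [Finset.sum_apply, smul_eq_C_mul] using hall f

/-- An irreducible representation of `G` embeds equivariantly into the polynomials of degree less
than `N`, as soon as the elements of `G` are linearly independent there. -/
theorem exists_equivariant_embedding
    (G : Subgroup (MvPolynomial (Fin d) k ≃ₐ[k] MvPolynomial (Fin d) k)) [Fintype G] {N : ℕ}
    (hN : ∀ c : G → k, c ≠ 0 → ∃ f : MvPolynomial (Fin d) k,
      (∀ g : G, (g.1 f).totalDegree < N) ∧ ∑ g : G, c g • g.1 f ≠ 0)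
    {U : Type} [AddCommGroup U] [Module k U] [Nontrivial U] (ρ : Representation k G U)
    (hirr : ∀ W : Submodule k U, (∀ (g : G), ∀ u ∈ W, ρ g u ∈ W) → W = ⊥ ∨ W = ⊤) :
    ∃ ψ : U →ₗ[k] MvPolynomial (Fin d) k, Function.Injective ψ ∧
      (∀ (g : G) u, ψ (ρ g u) = g.1 (ψ u)) ∧ ∀ u, (ψ u).totalDegree < N := by
  obtain ⟨u₀, hu₀⟩ := exists_ne (0 : U)
  obtain ⟨φ, hφ⟩ := not_forall.mp fun h =>
    hu₀ ((Module.forall_dual_apply_eq_zero_iff k u₀).mp h)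
  obtain ⟨f, hf, hne⟩ := hN (fun g => φ (ρ g⁻¹ u₀))
    (fun h => hφ (by simpa using congrFun h 1))
  let ψ : U →ₗ[k] MvPolynomial (Fin d) k :=
    ∑ g : G, (φ ∘ₗ ρ g⁻¹).smulRight (g.1 f)
  have hψ : ∀ u, ψ u = ∑ g : G, φ (ρ g⁻¹ u) • g.1 f := fun u => by
    simp [ψ, LinearMap.sum_apply]
  have heq : ∀ (g : G) u, ψ (ρ g u) = g.1 (ψ u) := by
    intro h u
    rw [hψ, hψ, map_sum]
    refine (Fintype.sum_equiv (Equiv.mulLeft h) _ _ fun g => ?_).symm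
    rw [map_smul, Equiv.coe_mulLeft, mul_inv_rev, ← Module.End.mul_apply, ← map_mul,
      inv_mul_cancel_right]
    rfl
  refine ⟨ψ, ?_, heq, fun u => ?_⟩
  · rw [← LinearMap.ker_eq_bot]
    refine (hirr (LinearMap.ker ψ) fun g u hu => ?_).resolve_right fun h => ?_
    · rw [LinearMap.mem_ker] at hu ⊢
      rw [heq, hu, map_zero]
    · exact hne ((hψ u₀).symm.trans (LinearMap.mem_ker.mp (h ▸ Submodule.mem_top)))
  · have h0 : 0 < N := (Nat.zero_le _).trans_lt (hf 1)
    rw [hψ]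
    refine (totalDegree_finsetSum _ _).trans_lt ((Finset.sup_lt_iff h0).mpr fun g _ => ?_)
    exact (totalDegree_smul_le _ _).trans_lt (hf g)

variable [IsAlgClosed k] (p : ℕ) (hp : p.Prime) [CharP k p] (e : ℕ)
  {U : Type} [AddCommGroup U] [Module k U]

/-- The `q`-th power of a polynomial, as an element of `S^q`. -/
noncomputable def qthPower (f : MvPolynomial (Fin d) k) : ↥(qthPowersSubalgebra k p hp d e) :=
  ⟨f ^ p ^ e, ⟨f, rfl⟩⟩

theorem qthPower_one : qthPower p hp e (1 : MvPolynomial (Fin d) k) = 1 :=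
  Subtype.ext (one_pow _)

theorem qthPower_mul (f g : MvPolynomial (Fin d) k) :
    qthPower p hp e (f * g) = qthPower p hp e f * qthPower p hp e g :=
  Subtype.ext (mul_pow _ _ _)

theorem qthPower_add (f g : MvPolynomial (Fin d) k) :
    qthPower p hp e (f + g) = qthPower p hp e f + qthPower p hp e g :=
  have := Fact.mk hp
  Subtype.ext (add_pow_char_pow ..)

theorem qthPower_C (a : k) :
    qthPower p hp e (C a : MvPolynomial (Fin d) k) = algebraMap k _ (a ^ p ^ e) :=
  Subtype.ext (map_pow C a _).symm

/-- The `S^q`-linear extension to `S` of a linear map defined on the monomials all of whose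
exponents are less than `q`. -/
noncomputable def qthPowersExtend (l : MvPolynomial (Fin d) k →ₗ[k] U) :
    MvPolynomial (Fin d) k →ₗ[k] ↥(qthPowersSubalgebra k p hp d e) ⊗[k] U :=
  (basisMonomials (Fin d) k).constr k fun c =>
    qthPower p hp e (monomial (c.mapRange (· / p ^ e) (Nat.zero_div _)) 1) ⊗ₜ[k]
      l (monomial (c.mapRange (· % p ^ e) (Nat.zero_mod _)) 1)

theorem qthPowersExtend_monomial (l : MvPolynomial (Fin d) k →ₗ[k] U) (c : Fin d →₀ ℕ) :
    qthPowersExtend p hp e l (monomial c 1) =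
      qthPower p hp e (monomial (c.mapRange (· / p ^ e) (Nat.zero_div _)) 1) ⊗ₜ[k]
        l (monomial (c.mapRange (· % p ^ e) (Nat.zero_mod _)) 1) := by
  rw [qthPowersExtend, show (monomial c 1 : MvPolynomial (Fin d) k) = basisMonomials (Fin d) k c
    from (congrFun (coe_basisMonomials (Fin d) k) c).symm, Module.Basis.constr_basis]

theorem qthPowersExtend_qthPower_mul (l : MvPolynomial (Fin d) k →ₗ[k] U)
    (h f : MvPolynomial (Fin d) k) :
    qthPowersExtend p hp e l (h ^ p ^ e * f) =
      qthPower p hp e h • qthPowersExtend p hp e l f := by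
  have hq : 0 < p ^ e := pow_pos hp.pos e
  induction h using MvPolynomial.induction_on' with
  | add a b ha hb =>
    have := Fact.mk hp
    rw [add_pow_char_pow, add_mul, map_add, ha, hb, qthPower_add, add_smul]
  | monomial b a =>
    have hC : (monomial b a : MvPolynomial (Fin d) k) = C a * monomial b 1 := by
      rw [C_mul_monomial, mul_one]
    rw [hC, qthPower_mul, qthPower_C, mul_smul, algebraMap_smul, mul_pow, ← map_pow, mul_assoc,
      ← smul_eq_C_mul, map_smul]
    congr 1
    induction f using MvPolynomial.induction_on' with
    | add f g hf hg => rw [mul_add, map_add, map_add, hf, hg, smul_add]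
    | monomial c r =>
      have hr : (monomial c r : MvPolynomial (Fin d) k) = r • monomial c 1 := by
        rw [smul_monomial, smul_eq_mul, mul_one]
      rw [hr, mul_smul_comm, map_smul, map_smul, smul_comm]
      congr 1
      rw [monomial_pow, one_pow, monomial_mul, one_mul, qthPowersExtend_monomial,
        qthPowersExtend_monomial, TensorProduct.smul_tmul', smul_eq_mul, ← qthPower_mul,
        monomial_mul, one_mul]
      congr 4
      · ext i
        simp [Nat.mul_add_div hq]
      · ext i
        simp

theorem qthPowersExtend_of_totalDegree_lt (l : MvPolynomial (Fin d) k →ₗ[k] U)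
    (f : MvPolynomial (Fin d) k) (hf : f.totalDegree < p ^ e) :
    qthPowersExtend p hp e l f = 1 ⊗ₜ[k] l f := by
  rw [f.as_sum, map_sum, map_sum, TensorProduct.tmul_sum]
  refine Finset.sum_congr rfl fun c hc => ?_
  have hlt : ∀ i, c i < p ^ e := fun i =>
    ((Finsupp.le_degree i c).trans (le_totalDegree hc)).trans_lt hf
  have hr : (monomial c (coeff c f) : MvPolynomial (Fin d) k) = coeff c f • monomial c 1 := by
    rw [smul_monomial, smul_eq_mul, mul_one]
  have hdiv : c.mapRange (· / p ^ e) (Nat.zero_div _) = 0 := by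
    ext i
    simpa using Nat.div_eq_of_lt (hlt i)
  have hmod : c.mapRange (· % p ^ e) (Nat.zero_mod _) = c := by
    ext i
    simpa using Nat.mod_eq_of_lt (hlt i)
  rw [hr, map_smul, map_smul, qthPowersExtend_monomial, hdiv, hmod, TensorProduct.tmul_smul]
  congr 2
  exact qthPower_one p hp e

/-- The `S^q`-linear extension `S^q ⊗ U → S` of a linear map `U → S`. -/
noncomputable def qthPowersLift (ψ : U →ₗ[k] MvPolynomial (Fin d) k) :
    ↥(qthPowersSubalgebra k p hp d e) ⊗[k] U →ₗ[k] MvPolynomial (Fin d) k :=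
  TensorProduct.lift
    ((LinearMap.mul k (MvPolynomial (Fin d) k)).compl₁₂
      (qthPowersSubalgebra k p hp d e).val.toLinearMap ψ)

theorem qthPowersLift_tmul (ψ : U →ₗ[k] MvPolynomial (Fin d) k)
    (s : ↥(qthPowersSubalgebra k p hp d e)) (u : U) :
    qthPowersLift p hp e ψ (s ⊗ₜ[k] u) = s * ψ u := rfl

theorem qthPowersLift_smul (ψ : U →ₗ[k] MvPolynomial (Fin d) k)
    (s : ↥(qthPowersSubalgebra k p hp d e)) (x : ↥(qthPowersSubalgebra k p hp d e) ⊗[k] U) :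
    qthPowersLift p hp e ψ (s • x) = s * qthPowersLift p hp e ψ x := by
  induction x with
  | zero => simp
  | add x y hx hy => rw [smul_add, map_add, map_add, hx, hy, mul_add]
  | tmul t u =>
    rw [TensorProduct.smul_tmul', qthPowersLift_tmul, qthPowersLift_tmul, smul_eq_mul,
      Subalgebra.coe_mul, mul_assoc]

theorem qthPowersExtend_qthPowersLift {ψ : U →ₗ[k] MvPolynomial (Fin d) k}
    {l : MvPolynomial (Fin d) k →ₗ[k] U} (hl : ∀ u, l (ψ u) = u)
    (hψ : ∀ u, (ψ u).totalDegree < p ^ e) (x : ↥(qthPowersSubalgebra k p hp d e) ⊗[k] U) :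
    qthPowersExtend p hp e l (qthPowersLift p hp e ψ x) = x := by
  induction x with
  | zero => simp
  | add x y hx hy => rw [map_add, map_add, hx, hy]
  | tmul s u =>
    obtain ⟨_, f, rfl⟩ := s
    rw [qthPowersLift_tmul, qthPowersExtend_qthPower_mul,
      qthPowersExtend_of_totalDegree_lt p hp e l _ (hψ u), hl, TensorProduct.smul_tmul',
      smul_eq_mul, mul_one]
    rfl

variable (G : Subgroup (MvPolynomial (Fin d) k ≃ₐ[k] MvPolynomial (Fin d) k))
  (ρ : Representation k G U)

/-- The diagonal action of `g` on `S^q ⊗ U`. -/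
noncomputable def qthPowersDiagonal (g : G) :
    ↥(qthPowersSubalgebra k p hp d e) ⊗[k] U →ₗ[k] ↥(qthPowersSubalgebra k p hp d e) ⊗[k] U :=
  TensorProduct.map (qthPowersRestrict k p hp d e G g) (ρ g)

theorem mem_qCovariants {x : ↥(qthPowersSubalgebra k p hp d e) ⊗[k] U} :
    x ∈ qCovariants k p hp d e G U ρ ↔ ∀ g, qthPowersDiagonal p hp e G ρ g x = x := by
  simp only [qCovariants, Submodule.mem_iInf, LinearMap.mem_eqLocus, LinearMap.id_apply,
    qthPowersDiagonal]

theorem qthPowersDiagonal_mul (g h : G) (x : ↥(qthPowersSubalgebra k p hp d e) ⊗[k] U) :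
    qthPowersDiagonal p hp e G ρ g (qthPowersDiagonal p hp e G ρ h x) =
      qthPowersDiagonal p hp e G ρ (g * h) x := by
  induction x with
  | zero => simp
  | add x y hx hy => simp only [map_add, hx, hy]
  | tmul s u =>
    simp only [qthPowersDiagonal, TensorProduct.map_tmul, map_mul, Module.End.mul_apply]
    rfl

theorem qthPowersDiagonal_smul {r : MvPolynomial (Fin d) k} {g : G} (hr : g.1 r = r)
    (x : ↥(qthPowersSubalgebra k p hp d e) ⊗[k] U) :
    qthPowersDiagonal p hp e G ρ g (qthPower p hp e r • x) =
      qthPower p hp e r • qthPowersDiagonal p hp e G ρ g x := by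
  induction x with
  | zero => simp
  | add x y hx hy => simp only [map_add, smul_add, hx, hy]
  | tmul s u =>
    simp only [qthPowersDiagonal, TensorProduct.smul_tmul', TensorProduct.map_tmul]
    congr 1
    refine Subtype.ext ?_
    change g.1 (r ^ p ^ e * s) = r ^ p ^ e * g.1 s
    rw [map_mul, map_pow, hr]

theorem qthPowersLift_qthPowersDiagonal {ψ : U →ₗ[k] MvPolynomial (Fin d) k} {g : G}
    (hψ : ∀ u, ψ (ρ g u) = g.1 (ψ u)) (x : ↥(qthPowersSubalgebra k p hp d e) ⊗[k] U) :
    qthPowersLift p hp e ψ (qthPowersDiagonal p hp e G ρ g x) =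
      g.1 (qthPowersLift p hp e ψ x) := by
  induction x with
  | zero => simp
  | add x y hx hy => simp only [map_add, hx, hy]
  | tmul s u =>
    rw [qthPowersDiagonal, TensorProduct.map_tmul, qthPowersLift_tmul, qthPowersLift_tmul, hψ,
      map_mul]
    rfl

/-- The average of the diagonal actions of the elements of `G` on `S^q ⊗ U`. -/
noncomputable def qthPowersReynolds [Fintype G] :
    ↥(qthPowersSubalgebra k p hp d e) ⊗[k] U →ₗ[k] ↥(qthPowersSubalgebra k p hp d e) ⊗[k] U :=
  (Nat.card G : k)⁻¹ • ∑ g : G, qthPowersDiagonal p hp e G ρ g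

theorem qthPowersReynolds_apply [Fintype G] (x : ↥(qthPowersSubalgebra k p hp d e) ⊗[k] U) :
    qthPowersReynolds p hp e G ρ x =
      (Nat.card G : k)⁻¹ • ∑ g : G, qthPowersDiagonal p hp e G ρ g x := by
  rw [qthPowersReynolds, LinearMap.smul_apply, LinearMap.sum_apply]

theorem qthPowersReynolds_mem [Fintype G] (x : ↥(qthPowersSubalgebra k p hp d e) ⊗[k] U) :
    qthPowersReynolds p hp e G ρ x ∈ qCovariants k p hp d e G U ρ := by
  rw [mem_qCovariants]
  intro h
  rw [qthPowersReynolds_apply, map_smul, map_sum]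
  congr 1
  exact Fintype.sum_equiv (Equiv.mulLeft h) _ _ fun g => qthPowersDiagonal_mul p hp e G ρ h g x

theorem qthPowersReynolds_of_mem [Fintype G] (hord : (Nat.card G : k) ≠ 0)
    {x : ↥(qthPowersSubalgebra k p hp d e) ⊗[k] U} (hx : x ∈ qCovariants k p hp d e G U ρ) :
    qthPowersReynolds p hp e G ρ x = x := by
  rw [mem_qCovariants] at hx
  rw [qthPowersReynolds_apply, Finset.sum_congr rfl fun g _ => hx g, Finset.sum_const,
    Finset.card_univ, ← Nat.card_eq_fintype_card, ← Nat.cast_smul_eq_nsmul k,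
    inv_smul_smul₀ hord]

theorem qthPowersReynolds_smul [Fintype G] {r : MvPolynomial (Fin d) k}
    (hr : ∀ g : G, g.1 r = r) (x : ↥(qthPowersSubalgebra k p hp d e) ⊗[k] U) :
    qthPowersReynolds p hp e G ρ (qthPower p hp e r • x) =
      qthPower p hp e r • qthPowersReynolds p hp e G ρ x := by
  simp only [qthPowersReynolds_apply]
  rw [Finset.sum_congr rfl fun g _ => qthPowersDiagonal_smul p hp e G ρ (hr g) x,
    ← Finset.smul_sum, smul_comm]

end

/-- In the tame linear setting, there is `e₀` such that for all `e ≥ e₀`,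
with `q = p^e`, for every irreducible finite-dimensional representation `U` of `G`, the
module of covariants `R^q(U) = (S^q ⊗_k U)^G` is a direct summand of `R` as an
`R^q`-module: there are maps `ι : R^q(U) → R` and `π : R → R^q(U)`, `k`-linear and
`R^q`-linear (the latter expressed elementwise), with `π ∘ ι = id`. -/
theorem statement5 (k : Type) [Field k] [IsAlgClosed k] (p : ℕ) (hp : p.Prime) [CharP k p]
    (d : ℕ) (hd : 1 ≤ d)
    (G : Subgroup (MvPolynomial (Fin d) k ≃ₐ[k] MvPolynomial (Fin d) k)) [Finite G]
    (hlin : ∀ (g : G) (i : Fin d),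
      (g : MvPolynomial (Fin d) k ≃ₐ[k] MvPolynomial (Fin d) k) (X i) ∈
        Submodule.span k (Set.range (X : Fin d → MvPolynomial (Fin d) k)))
    (hord : ¬ p ∣ Nat.card G) :
    ∃ e₀ : ℕ, ∀ e : ℕ, e₀ ≤ e →
      ∀ (U : Type) [AddCommGroup U] [Module k U] (ρ : Representation k G U),
        FiniteDimensional k U → Nontrivial U →
        (∀ W : Submodule k U, (∀ (g : G), ∀ u ∈ W, ρ g u ∈ W) → W = ⊥ ∨ W = ⊤) →
        ∃ (ι : ↥(qCovariants k p hp d e G U ρ) →ₗ[k] ↥(invariantsSubalgebra k d G))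
          (π : ↥(invariantsSubalgebra k d G) →ₗ[k] ↥(qCovariants k p hp d e G U ρ)),
          (∀ x, π (ι x) = x) ∧
          ∀ r : MvPolynomial (Fin d) k,
            (∀ g : G, (g : MvPolynomial (Fin d) k ≃ₐ[k] MvPolynomial (Fin d) k) r = r) →
            (∀ (x : ↥(qthPowersSubalgebra k p hp d e) ⊗[k] U)
                (hx : x ∈ qCovariants k p hp d e G U ρ)
                (hrx : (⟨r ^ p ^ e, ⟨r, rfl⟩⟩ : ↥(qthPowersSubalgebra k p hp d e)) • x ∈
                  qCovariants k p hp d e G U ρ),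
              (ι ⟨_, hrx⟩ : MvPolynomial (Fin d) k) =
                r ^ p ^ e * (ι ⟨x, hx⟩ : MvPolynomial (Fin d) k)) ∧
            (∀ (s : MvPolynomial (Fin d) k) (hs : s ∈ invariantsSubalgebra k d G)
                (hrs : r ^ p ^ e * s ∈ invariantsSubalgebra k d G),
              ((π ⟨r ^ p ^ e * s, hrs⟩ : ↥(qCovariants k p hp d e G U ρ)) :
                  ↥(qthPowersSubalgebra k p hp d e) ⊗[k] U) =
                (⟨r ^ p ^ e, ⟨r, rfl⟩⟩ : ↥(qthPowersSubalgebra k p hp d e)) •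
                  ((π ⟨s, hs⟩ : ↥(qCovariants k p hp d e G U ρ)) :
                    ↥(qthPowersSubalgebra k p hp d e) ⊗[k] U)) := by
  have : Fintype G := Fintype.ofFinite G
  obtain ⟨N, hN⟩ := exists_totalDegree_bound_sum_ne_zero G
  refine ⟨N, fun e he U _ _ ρ _ _ hirr => ?_⟩
  obtain ⟨ψ, hinj, hequiv, hdeg⟩ := exists_equivariant_embedding G hN ρ hirr
  have hNq : N ≤ p ^ e := he.trans (Nat.lt_pow_self hp.one_lt).le
  obtain ⟨l, hl⟩ := ψ.exists_leftInverse_of_injective (LinearMap.ker_eq_bot.mpr hinj)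
  have hcard : (Nat.card G : k) ≠ 0 := fun h => hord ((CharP.cast_eq_zero_iff k p _).mp h)
  have hext := qthPowersExtend_qthPowersLift p hp e (LinearMap.congr_fun hl)
    fun u => (hdeg u).trans_le hNq
  let ι : ↥(qCovariants k p hp d e G U ρ) →ₗ[k]
      ↥(Subalgebra.toSubmodule (invariantsSubalgebra k d G)) :=
    (qthPowersLift p hp e ψ ∘ₗ (qCovariants k p hp d e G U ρ).subtype).codRestrict _ fun x g =>
      (qthPowersLift_qthPowersDiagonal p hp e G ρ (hequiv g) x.1).symm.trans
        (congrArg _ ((mem_qCovariants p hp e G ρ).mp x.2 g))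
  let π : ↥(invariantsSubalgebra k d G) →ₗ[k] ↥(qCovariants k p hp d e G U ρ) :=
    (qthPowersReynolds p hp e G ρ ∘ₗ qthPowersExtend p hp e l ∘ₗ
      (invariantsSubalgebra k d G).val.toLinearMap).codRestrict _ fun _ =>
        qthPowersReynolds_mem p hp e G ρ _
  refine ⟨ι, π, fun x => Subtype.ext ?_, fun r hr => ⟨fun x _ _ => ?_, fun s _ _ => ?_⟩⟩
  · exact (congrArg _ (hext x.1)).trans (qthPowersReynolds_of_mem p hp e G ρ hcard x.2)
  · exact qthPowersLift_smul p hp e ψ (qthPower p hp e r) x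
  · exact (congrArg _ (qthPowersExtend_qthPower_mul p hp e l r s)).trans
      (qthPowersReynolds_smul p hp e G ρ hr _)
end
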